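/- Let (R, m) be an n-dimensional local regular domain (n > 1) containing an algebraically closed field k with k ≅ R/m, and let (T, n) be an n-dimensional local regular domain obtained from R by a finite sequence of quadratic transformations R = R₀ ⊆ R₁ ⊆ ⋯ ⊆ R_m = T. Let x₁,...,xₙ generate m. Then there exist a regular system of parameters y₁,...,yₙ of T and polynomials A₁,...,Aₙ ∈ k[Y₁,...,Yₙ] such that x_j = A_j(y₁,...,yₙ) for each j. -/

import Mathlib

set_option synthInstance.maxHeartbeats 1000000
set_option maxHeartbeats 2000000

open IsLocalRing

noncomputable section

/-- The ideal generated by the nonunits of a ring (the maximal ideal, if the ring is local). -/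
def nuIdeal (A : Type*) [CommRing A] : Ideal A := Ideal.span {a : A | ¬ IsUnit a}

/-- A commutative ring is regular local if it is a Noetherian local ring whose maximal ideal
can be generated by `dim` elements. -/
def IsRegLoc (A : Type*) [CommRing A] : Prop :=
  IsLocalRing A ∧ IsNoetherianRing A ∧
    ∃ s : Finset A, (Ideal.span (s : Set A) = nuIdeal A) ∧
      ((s.card : ℕ) : WithBot (WithTop ℕ)) = ringKrullDim A

variable (R : Type*) [CommRing R] [IsDomain R]

/-- The ring `A[m_A/x]` inside the fraction field (where `m_A` is the ideal generated by
the nonunits of `A`, i.e. the maximal ideal when `A` is local). -/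
def S1 (A : Subalgebra R (FractionRing R)) (x : A) : Subalgebra R (FractionRing R) :=
  Algebra.adjoin R ((A : Set (FractionRing R)) ∪
    {z | ∃ a : A, a ∈ nuIdeal A ∧ z = (a : FractionRing R) / (x : FractionRing R)})

/-- The localization of a subalgebra `S` of the fraction field at a prime `p`, realized as a
subalgebra of the fraction field: `S[(S \ p)⁻¹]`. -/
def locSub (S : Subalgebra R (FractionRing R)) (p : Ideal S) : Subalgebra R (FractionRing R) :=
  Algebra.adjoin R ((S : Set (FractionRing R)) ∪
    {z | ∃ s : S, s ∉ p ∧ z = (s : FractionRing R)⁻¹})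

/-- `x`, viewed as an element of `A[m_A/x]`. -/
def xIn (A : Subalgebra R (FractionRing R)) (x : A) : S1 R A x :=
  ⟨(x : FractionRing R), Algebra.subset_adjoin (Or.inl x.2)⟩

/-- `B` is a (first) quadratic transform of `A`: there are `x ∈ m_A \ m_A²` and a prime ideal
`p` of `S := A[m_A/x]` containing `x` such that `B = S_p`. -/
def QuadStep (A B : Subalgebra R (FractionRing R)) : Prop :=
  ∃ x : A, x ∈ nuIdeal A ∧ x ∉ (nuIdeal A) ^ 2 ∧
    ∃ p : Ideal (S1 R A x), p.IsPrime ∧ xIn R A x ∈ p ∧ B = locSub R (S1 R A x) p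

open Polynomial in
lemma ringKrullDim_le_of_surjective_eval₂ {D D' : Type*} [CommRing D] [IsDomain D]
    [IsNoetherianRing D] [CommRing D'] (i : D →+* D') (t : D')
    (hsurj : Function.Surjective (eval₂RingHom i t)) (a b : D) (hb : b ≠ 0)
    (hab : i b * t = i a) :
    IsNoetherianRing D' ∧ ringKrullDim D' ≤ ringKrullDim D := by
  refine ⟨isNoetherianRing_of_surjective _ _ _ hsurj, ?_⟩
  let g : D[X] := C b * X - C a
  have hg0 : g ≠ 0 := by
    intro h
    have h1 : g.coeff 1 = 0 := by rw [h]; simp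
    simp only [g, coeff_sub, coeff_C_mul, coeff_X_one, mul_one, coeff_C_succ, sub_zero] at h1
    exact hb h1
  have hfg : eval₂RingHom i t g = 0 := by simp [g, hab]
  have hle : ringKrullDim D' ≤ ringKrullDim (D[X] ⧸ Ideal.span {g}) := by
    refine ringKrullDim_le_of_surjective (Ideal.Quotient.lift _ (eval₂RingHom i t) ?_)
      (Ideal.Quotient.lift_surjective_of_surjective _ _ hsurj)
    intro z hz
    obtain ⟨c, rfl⟩ := Ideal.mem_span_singleton.1 hz
    rw [map_mul, hfg, zero_mul]
  have h := ringKrullDim_quotient_succ_le_of_nonZeroDivisor (mem_nonZeroDivisors_of_ne_zero hg0)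
  rw [Polynomial.ringKrullDim_of_isNoetherianRing] at h
  exact hle.trans (ENat.WithBot.add_le_add_one_right_iff.1 h)

open Polynomial in
lemma ringKrullDim_adjoin_insert_le (D : Subalgebra R (FractionRing R)) [IsNoetherianRing D]
    (t : FractionRing R) :
    IsNoetherianRing (Algebra.adjoin R ((D : Set (FractionRing R)) ∪ {t})) ∧
      ringKrullDim (Algebra.adjoin R ((D : Set (FractionRing R)) ∪ {t})) ≤ ringKrullDim D := by
  set D' := Algebra.adjoin R ((D : Set (FractionRing R)) ∪ {t})
  have hD : ∀ d : D, (d : FractionRing R) ∈ D' := fun d ↦ Algebra.subset_adjoin (Or.inl d.2)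
  have ht : t ∈ D' := Algebra.subset_adjoin (Or.inr rfl)
  let i : D →+* D' := (Subalgebra.inclusion (fun d hd ↦ hD ⟨d, hd⟩) : D →ₐ[R] D').toRingHom
  have hfC : ∀ d : D, eval₂RingHom i ⟨t, ht⟩ (C d) = i d := fun d ↦ by simp
  have hfX : eval₂RingHom i ⟨t, ht⟩ X = ⟨t, ht⟩ := by simp
  obtain ⟨a, b, hb, hab⟩ := IsFractionRing.div_surjective (A := R) t
  have hb0 : algebraMap R (FractionRing R) b ≠ 0 := by
    simpa using nonZeroDivisors.ne_zero hb
  refine ringKrullDim_le_of_surjective_eval₂ i ⟨t, ht⟩ ?_ (algebraMap R D a) (algebraMap R D b)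
    (fun h ↦ hb0 (congrArg Subtype.val h)) ?_
  · rintro ⟨z, hz⟩
    induction hz using Algebra.adjoin_induction with
    | mem z hz =>
      rcases hz with hz | rfl
      · exact ⟨C ⟨z, hz⟩, hfC _⟩
      · exact ⟨X, hfX⟩
    | algebraMap r => exact ⟨C (algebraMap R D r), hfC _⟩
    | add a b ha hb iha ihb =>
      obtain ⟨p, hp⟩ := iha
      obtain ⟨q, hq⟩ := ihb
      exact ⟨p + q, by rw [map_add, hp, hq]; rfl⟩
    | mul a b ha hb iha ihb =>
      obtain ⟨p, hp⟩ := iha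
      obtain ⟨q, hq⟩ := ihb
      exact ⟨p * q, by rw [map_mul, hp, hq]; rfl⟩
  · apply Subtype.ext
    change algebraMap R (FractionRing R) b * t = algebraMap R (FractionRing R) a
    rw [← hab]
    field_simp

lemma ringKrullDim_adjoin_union_le (D : Subalgebra R (FractionRing R)) [IsNoetherianRing D]
    (E : Finset (FractionRing R)) :
    IsNoetherianRing (Algebra.adjoin R ((D : Set (FractionRing R)) ∪ E)) ∧
      ringKrullDim (Algebra.adjoin R ((D : Set (FractionRing R)) ∪ E)) ≤ ringKrullDim D := by
  classical
  induction E using Finset.induction_on with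
  | empty =>
    have h : Algebra.adjoin R ((D : Set (FractionRing R)) ∪ (∅ : Finset (FractionRing R))) = D := by
      rw [Finset.coe_empty, Set.union_empty, Algebra.adjoin_eq]
    rw [h]
    exact ⟨inferInstance, le_rfl⟩
  | insert t E _ ih =>
    obtain ⟨h1, h2⟩ := ih
    have h : Algebra.adjoin R ((D : Set (FractionRing R)) ∪ (insert t E : Finset (FractionRing R)))
        = Algebra.adjoin R
          ((Algebra.adjoin R ((D : Set (FractionRing R)) ∪ E) : Set (FractionRing R)) ∪ {t}) := by
      rw [Algebra.adjoin_union _ {t}, Algebra.adjoin_eq, ← Algebra.adjoin_union,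
        Finset.coe_insert, Set.union_assoc, Set.union_singleton]
    rw [h]
    have := ringKrullDim_adjoin_insert_le R (Algebra.adjoin R ((D : Set (FractionRing R)) ∪ E)) t
    exact ⟨this.1, this.2.trans h2⟩

lemma isMaximal_of_ringKrullDim_le_height {S : Type*} [CommRing S] {p : Ideal S} [p.IsPrime]
    {n : ℕ} (hS : ringKrullDim S ≤ n) (hp : n ≤ (p.height : WithBot ℕ∞)) : p.IsMaximal := by
  have hle := Ideal.height_le_ringKrullDim_of_ne_top (I := p) Ideal.IsPrime.ne_top'
  have : FiniteRingKrullDim S := finiteRingKrullDim_iff_ne_bot_and_top.2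
    ⟨fun h ↦ WithBot.coe_ne_bot (le_bot_iff.1 (h ▸ hle)),
      fun h ↦ absurd (WithBot.coe_le_coe.1 (h ▸ hS)) (by simp)⟩
  exact Ideal.isMaximal_of_height_eq_ringKrullDim (le_antisymm hle (hS.trans hp))

lemma nuIdeal_eq_maximalIdeal (A : Type*) [CommRing A] [IsLocalRing A] :
    nuIdeal A = maximalIdeal A :=
  Ideal.span_eq (maximalIdeal A)

lemma le_S1 (A : Subalgebra R (FractionRing R)) (x : A) : A ≤ S1 R A x :=
  fun _ ha ↦ Algebra.subset_adjoin (Or.inl ha)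

lemma S1_eq_adjoin_of_span (A : Subalgebra R (FractionRing R)) (x : A) (s : Set A)
    (hs : Ideal.span s = nuIdeal A) :
    S1 R A x = Algebra.adjoin R ((A : Set (FractionRing R)) ∪
      (fun a : A ↦ (a : FractionRing R) / (x : FractionRing R)) '' s) := by
  apply le_antisymm
  · apply Algebra.adjoin_le
    rintro z (hz | ⟨a, ha, rfl⟩)
    · exact Algebra.subset_adjoin (Or.inl hz)
    · rw [← hs] at ha
      induction ha using Submodule.span_induction with
      | mem a ha => exact Algebra.subset_adjoin (Or.inr ⟨a, ha, rfl⟩)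
      | zero => simp
      | add a b _ _ iha ihb =>
        simp only [Subalgebra.coe_add, add_div]
        exact add_mem iha ihb
      | smul c a _ ih =>
        simp only [smul_eq_mul, Subalgebra.coe_mul, mul_div_assoc]
        exact mul_mem (Algebra.subset_adjoin (Or.inl c.2)) ih
  · apply Algebra.adjoin_mono
    apply Set.union_subset_union_right
    rintro _ ⟨a, ha, rfl⟩
    exact ⟨a, hs ▸ Ideal.subset_span ha, rfl⟩

lemma ringKrullDim_S1_le (A : Subalgebra R (FractionRing R)) [IsNoetherianRing A] (x : A) :
    IsNoetherianRing (S1 R A x) ∧ ringKrullDim (S1 R A x) ≤ ringKrullDim A := by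
  classical
  obtain ⟨s, hs⟩ := (isNoetherianRing_iff_ideal_fg A).1 ‹_› (nuIdeal A)
  have h := ringKrullDim_adjoin_union_le R A
    (s.image fun a : A ↦ (a : FractionRing R) / (x : FractionRing R))
  rw [Finset.coe_image, ← S1_eq_adjoin_of_span R A x s hs] at h
  exact h

lemma le_locSub (S : Subalgebra R (FractionRing R)) (p : Ideal S) : S ≤ locSub R S p :=
  fun _ hs ↦ Algebra.subset_adjoin (Or.inl hs)

/-- The inclusion of `S` into its localization at `p`, as an algebra structure. -/
abbrev locSubAlgebra (S : Subalgebra R (FractionRing R)) (p : Ideal S) :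
    Algebra S (locSub R S p) :=
  (Subalgebra.inclusion (le_locSub R S p)).toRingHom.toAlgebra

lemma exists_mul_eq_of_mem_locSub (S : Subalgebra R (FractionRing R)) (p : Ideal S) [p.IsPrime]
    {z : FractionRing R} (hz : z ∈ locSub R S p) :
    ∃ s u : S, u ∉ p ∧ z * (u : FractionRing R) = (s : FractionRing R) := by
  have h1 : (1 : S) ∉ p := (Ideal.ne_top_iff_one p).1 Ideal.IsPrime.ne_top'
  have hmul : ∀ {u v : S}, u ∉ p → v ∉ p → u * v ∉ p := fun hu hv h ↦
    (Ideal.IsPrime.mem_or_mem ‹_› h).elim hu hv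
  induction hz using Algebra.adjoin_induction with
  | mem z hz =>
    rcases hz with hz | ⟨s, hs, rfl⟩
    · exact ⟨⟨z, hz⟩, 1, h1, by simp⟩
    · refine ⟨1, s, hs, ?_⟩
      have : (s : FractionRing R) ≠ 0 := fun h ↦ hs (by
        rw [show s = 0 from Subtype.ext h]; exact p.zero_mem)
      simp [this]
  | algebraMap r => exact ⟨algebraMap R S r, 1, h1, by simp⟩
  | add a b _ _ iha ihb =>
    obtain ⟨s, u, hu, h⟩ := iha
    obtain ⟨s', u', hu', h'⟩ := ihb
    refine ⟨s * u' + s' * u, u * u', hmul hu hu', ?_⟩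
    push_cast
    rw [← h, ← h']
    ring
  | mul a b _ _ iha ihb =>
    obtain ⟨s, u, hu, h⟩ := iha
    obtain ⟨s', u', hu', h'⟩ := ihb
    refine ⟨s * s', u * u', hmul hu hu', ?_⟩
    push_cast
    rw [← h, ← h']
    ring

lemma isLocalization_locSub (S : Subalgebra R (FractionRing R)) (p : Ideal S) [p.IsPrime] :
    letI := locSubAlgebra R S p
    IsLocalization.AtPrime (locSub R S p) p := by
  let := locSubAlgebra R S p
  refine ⟨?_, ?_, ?_⟩
  · rintro ⟨u, hu⟩
    have hu0 : (u : FractionRing R) ≠ 0 := fun h ↦ hu (by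
      rw [show u = 0 from Subtype.ext h]; exact p.zero_mem)
    refine IsUnit.of_mul_eq_one
      (⟨(u : FractionRing R)⁻¹, Algebra.subset_adjoin (Or.inr ⟨u, hu, rfl⟩)⟩ : locSub R S p) ?_
    exact Subtype.ext (mul_inv_cancel₀ hu0)
  · rintro ⟨z, hz⟩
    obtain ⟨s, u, hu, h⟩ := exists_mul_eq_of_mem_locSub R S p hz
    exact ⟨⟨s, ⟨u, hu⟩⟩, Subtype.ext h⟩
  · intro a b h
    refine ⟨1, ?_⟩
    rw [Subalgebra.inclusion_injective (le_locSub R S p) h]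

lemma QuadStep.isLocalRing_and_ringKrullDim_le {A B : Subalgebra R (FractionRing R)}
    [IsNoetherianRing A] (h : QuadStep R A B) :
    IsLocalRing B ∧ IsNoetherianRing B ∧ ringKrullDim B ≤ ringKrullDim A := by
  obtain ⟨x, -, -, p, hp, -, rfl⟩ := h
  let := locSubAlgebra R (S1 R A x) p
  have hloc := isLocalization_locSub R (S1 R A x) p
  obtain ⟨hN, hd⟩ := ringKrullDim_S1_le R A x
  refine ⟨IsLocalization.AtPrime.isLocalRing _ p,
    IsLocalization.isNoetherianRing p.primeCompl _ hN, ?_⟩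
  rw [IsLocalization.AtPrime.ringKrullDim_eq_height p]
  exact (Ideal.height_le_ringKrullDim_of_ne_top hp.ne_top).trans hd

/-- The subalgebra `k + I` of a `k`-algebra, for an ideal `I`. -/
def scalarsAddIdeal (k : Type*) [Field k] {B : Type*} [CommRing B] [Algebra k B] (I : Ideal B) :
    Subalgebra k B :=
  (⊥ : Subalgebra k (B ⧸ I)).comap (Ideal.Quotient.mkₐ k I)

section Scalars

variable {k : Type*} [Field k] {B : Type*} [CommRing B] [Algebra k B]

lemma mem_scalarsAddIdeal {I : Ideal B} {b : B} :
    b ∈ scalarsAddIdeal k I ↔ ∃ c : k, b - algebraMap k B c ∈ I := by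
  simp only [scalarsAddIdeal, Subalgebra.mem_comap, Algebra.mem_bot, Set.mem_range]
  refine exists_congr fun c ↦ ?_
  rw [← Ideal.Quotient.eq]
  exact eq_comm

lemma mem_scalarsAddIdeal_of_mem {I : Ideal B} {b : B} (hb : b ∈ I) :
    b ∈ scalarsAddIdeal k I :=
  mem_scalarsAddIdeal.2 ⟨0, by simpa using hb⟩

lemma mem_scalarsAddIdeal_of_mul_eq_one {I : Ideal B} (hI : I ≠ ⊤) {u v : B}
    (hv : v ∈ scalarsAddIdeal k I) (huv : u * v = 1) : u ∈ scalarsAddIdeal k I := by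
  obtain ⟨c, hc⟩ := mem_scalarsAddIdeal.1 hv
  have hc0 : c ≠ 0 := by
    rintro rfl
    refine hI (I.eq_top_of_isUnit_mem (x := v) (by simpa using hc) ?_)
    exact IsUnit.of_mul_eq_one u (by rw [mul_comm, huv])
  refine mem_scalarsAddIdeal.2 ⟨c⁻¹, ?_⟩
  have h1 : algebraMap k B c⁻¹ * algebraMap k B c = 1 := by
    rw [← map_mul, inv_mul_cancel₀ hc0, map_one]
  have h2 : u - algebraMap k B c⁻¹ = -(u * algebraMap k B c⁻¹) * (v - algebraMap k B c) := by
    linear_combination (-u) * h1 + algebraMap k B c⁻¹ * huv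
  rw [h2]
  exact I.mul_mem_left _ hc

lemma mem_scalarsAddIdeal_of_isMaximal [IsAlgClosed k] (p : Ideal B) [p.IsMaximal]
    {ι : Type*} [Finite ι] (t : ι → B)
    (h : ∀ b : B, ∃ q ∈ Algebra.adjoin k (Set.range t), b - q ∈ p) (b : B) :
    b ∈ scalarsAddIdeal k p := by
  let : Field (B ⧸ p) := Ideal.Quotient.field p
  have hft : Algebra.FiniteType k (B ⧸ p) := by
    refine ⟨⟨(Set.finite_range (fun i ↦ Ideal.Quotient.mkₐ k p (t i))).toFinset, ?_⟩⟩
    rw [Set.Finite.coe_toFinset, eq_top_iff]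
    rintro z -
    obtain ⟨b, rfl⟩ := Ideal.Quotient.mk_surjective z
    obtain ⟨q, hq, hbq⟩ := h b
    rw [Ideal.Quotient.eq.2 hbq]
    have h1 := AlgHom.map_adjoin (Ideal.Quotient.mkₐ k p) (Set.range t)
    rw [← Set.range_comp] at h1
    exact h1 ▸ ⟨q, hq, rfl⟩
  have hfin : Module.Finite k (B ⧸ p) := finite_of_finite_type_of_isJacobsonRing k (B ⧸ p)
  obtain ⟨c, hc⟩ := (IsAlgClosed.algebraMap_bijective_of_isIntegral (k := k) (K := B ⧸ p)).2
    (Ideal.Quotient.mk p b)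
  exact mem_scalarsAddIdeal.2 ⟨c, Ideal.Quotient.eq.1 hc.symm⟩

lemma exists_monoidal_parameters [IsLocalRing B] (hB : ∀ b, b ∈ scalarsAddIdeal k (maximalIdeal B))
    {ι : Type*} [Fintype ι] {x : B} (hx : x ∈ maximalIdeal B) (t r : ι → B)
    (hrt : ∑ i, r i * t i = 1)
    (hr : ∀ i, r i ∈ scalarsAddIdeal k (Ideal.span (Set.range fun i ↦ x * t i))) :
    ∃ y : ι → B, (∀ i, y i ∈ maximalIdeal B) ∧
      (∀ i, x * t i ∈ Algebra.adjoin k (Set.range y)) ∧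
      x ∈ Ideal.span (Set.range y) ∧ ∀ i, t i ∈ scalarsAddIdeal k (Ideal.span (Set.range y)) := by
  classical
  obtain ⟨j, hj⟩ : ∃ j, IsUnit (t j) := by
    by_contra! h
    have : (1 : B) ∈ maximalIdeal B :=
      hrt ▸ Ideal.sum_mem _ fun i _ ↦ Ideal.mul_mem_left _ _ ((mem_maximalIdeal _).2 (h i))
    exact (mem_maximalIdeal _).1 this isUnit_one
  obtain ⟨v, hv⟩ := hj.exists_right_inv
  choose a ha using fun l ↦ mem_scalarsAddIdeal.1 (hB (t l * v))
  let y : ι → B := Function.update (fun l ↦ t l * v - algebraMap k B (a l)) j (x * t j)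
  have hyj : y j = x * t j := Function.update_self ..
  have hyl : ∀ l, l ≠ j → y l = t l * v - algebraMap k B (a l) := fun l hl ↦
    Function.update_of_ne hl ..
  have hym : ∀ i, y i ∈ maximalIdeal B := by
    intro i
    by_cases hi : i = j
    · rw [hi, hyj]
      exact Ideal.mul_mem_right _ _ hx
    · rw [hyl i hi]
      exact ha i
  set I := Ideal.span (Set.range y)
  have hyI : ∀ i, y i ∈ I := fun i ↦ Ideal.subset_span ⟨i, rfl⟩
  have hItop : I ≠ ⊤ := fun h ↦ (maximalIdeal.isMaximal B).ne_top
    (eq_top_iff.2 (h ▸ Ideal.span_le.2 (by rintro _ ⟨i, rfl⟩; exact hym i)))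
  have hxI : x ∈ I := by
    have : x = v * y j := by rw [hyj]; linear_combination (-x) * hv
    rw [this]
    exact I.mul_mem_left _ (hyI j)
  have htv : ∀ l, t l * v ∈ scalarsAddIdeal k I := by
    intro l
    by_cases hl : l = j
    · rw [hl, hv]
      exact one_mem _
    · exact mem_scalarsAddIdeal.2 ⟨a l, hyl l hl ▸ hyI l⟩
  have hrI : ∀ i, r i ∈ scalarsAddIdeal k I := by
    intro i
    obtain ⟨c, hc⟩ := mem_scalarsAddIdeal.1 (hr i)
    refine mem_scalarsAddIdeal.2 ⟨c, ?_⟩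
    refine (Ideal.span_le.2 ?_ : Ideal.span (Set.range fun i ↦ x * t i) ≤ I) hc
    rintro _ ⟨i, rfl⟩
    exact I.mul_mem_right _ hxI
  have hvI : v ∈ scalarsAddIdeal k I := by
    have : v = ∑ i, r i * (t i * v) := by
      simp_rw [← mul_assoc]
      rw [← Finset.sum_mul, hrt, one_mul]
    rw [this]
    exact sum_mem fun i _ ↦ mul_mem (hrI i) (htv i)
  have htj : t j ∈ scalarsAddIdeal k I := mem_scalarsAddIdeal_of_mul_eq_one hItop hvI hv
  refine ⟨y, hym, fun l ↦ ?_, hxI, fun l ↦ ?_⟩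
  · have hy : ∀ i, y i ∈ Algebra.adjoin k (Set.range y) := fun i ↦
      Algebra.subset_adjoin ⟨i, rfl⟩
    by_cases hl : l = j
    · rw [hl, ← hyj]
      exact hy j
    · have : x * t l = y j * (y l + algebraMap k B (a l)) := by
        rw [hyj, hyl l hl]
        linear_combination (-x * t l) * hv
      rw [this]
      exact mul_mem (hy j) (add_mem (hy l) (Subalgebra.algebraMap_mem _ _))
  · have : t l = t l * v * t j := by linear_combination (-t l) * hv
    rw [this]
    exact mul_mem (htv l) htj

end Scalars

section Step

variable {k : Type*} [Field k] [Algebra k R]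

lemma mem_scalarsAddIdeal_S1 [IsAlgClosed k] (A : Subalgebra R (FractionRing R))
    {ι : Type*} [Finite ι] (y : ι → A) (hy : Ideal.span (Set.range y) = nuIdeal A)
    (hA : ∀ a, a ∈ scalarsAddIdeal k (nuIdeal A)) (x : A) (hx0 : x ≠ 0)
    (p : Ideal (S1 R A x)) [p.IsMaximal] (hxp : xIn R A x ∈ p) (s : S1 R A x) :
    s ∈ scalarsAddIdeal k p := by
  have hx0' : (x : FractionRing R) ≠ 0 := fun h ↦ hx0 (Subtype.ext h)
  let i : A →ₐ[R] S1 R A x := Subalgebra.inclusion (le_S1 R A x)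
  let t : ι → S1 R A x := fun l ↦ ⟨(y l : FractionRing R) / x,
    Algebra.subset_adjoin (Or.inr ⟨y l, hy ▸ Ideal.subset_span ⟨l, rfl⟩, rfl⟩)⟩
  have hit : ∀ l, i (y l) = t l * xIn R A x := fun l ↦ Subtype.ext (by
    change (y l : FractionRing R) = y l / x * x
    field_simp)
  have hnu : ∀ a ∈ nuIdeal A, i a ∈ p := by
    intro a ha
    rw [← hy] at ha
    refine (Ideal.span_le.2 ?_ : Ideal.span (Set.range y) ≤ p.comap i) ha
    rintro _ ⟨l, rfl⟩
    change i (y l) ∈ p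
    rw [hit]
    exact p.mul_mem_left _ hxp
  have hiA : ∀ a : A, ∃ q ∈ Algebra.adjoin k (Set.range t), i a - q ∈ p := by
    intro a
    obtain ⟨c, hc⟩ := mem_scalarsAddIdeal.1 (hA a)
    refine ⟨algebraMap k _ c, Subalgebra.algebraMap_mem _ _, ?_⟩
    have := hnu _ hc
    rwa [map_sub] at this
  refine mem_scalarsAddIdeal_of_isMaximal p t ?_ s
  rintro ⟨z, hz⟩
  have hz' := hz
  rw [S1_eq_adjoin_of_span R A x _ hy] at hz'
  suffices ∀ hz : z ∈ S1 R A x, ∃ q ∈ Algebra.adjoin k (Set.range t), (⟨z, hz⟩ : S1 R A x) - q ∈ p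
    from this hz
  clear hz
  induction hz' using Algebra.adjoin_induction with
  | mem z hz =>
    intro hzS
    rcases hz with hz | ⟨_, ⟨l, rfl⟩, rfl⟩
    · exact hiA ⟨z, hz⟩
    · exact ⟨t l, Algebra.subset_adjoin ⟨l, rfl⟩, by
        rw [show (⟨_, hzS⟩ : S1 R A x) = t l from rfl, sub_self]; exact p.zero_mem⟩
  | algebraMap r =>
    intro _
    exact hiA (algebraMap R A r)
  | add a b ha hb iha ihb =>
    intro _
    rw [← S1_eq_adjoin_of_span R A x _ hy] at ha hb
    obtain ⟨q, hq, h⟩ := iha ha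
    obtain ⟨q', hq', h'⟩ := ihb hb
    refine ⟨q + q', add_mem hq hq', ?_⟩
    have := p.add_mem h h'
    rw [sub_add_sub_comm] at this
    exact this
  | mul a b ha hb iha ihb =>
    intro _
    rw [← S1_eq_adjoin_of_span R A x _ hy] at ha hb
    obtain ⟨q, hq, h⟩ := iha ha
    obtain ⟨q', hq', h'⟩ := ihb hb
    refine ⟨q * q', mul_mem hq hq', ?_⟩
    have := p.add_mem (p.mul_mem_left ⟨a, ha⟩ h') (p.mul_mem_right q' h)
    rw [mul_sub, sub_mul, sub_add_sub_cancel] at this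
    exact this

lemma mem_scalarsAddIdeal_locSub (S : Subalgebra R (FractionRing R)) (p : Ideal S) [p.IsPrime]
    [IsLocalRing (locSub R S p)] (hS : ∀ s, s ∈ scalarsAddIdeal k p) (b : locSub R S p) :
    b ∈ scalarsAddIdeal k (maximalIdeal (locSub R S p)) := by
  let := locSubAlgebra R S p
  have hloc := isLocalization_locSub R S p
  have hS' : ∀ s : S, algebraMap S (locSub R S p) s ∈
      scalarsAddIdeal k (maximalIdeal (locSub R S p)) := by
    intro s
    obtain ⟨c, hc⟩ := mem_scalarsAddIdeal.1 (hS s)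
    refine mem_scalarsAddIdeal.2 ⟨c, ?_⟩
    have := (IsLocalization.AtPrime.to_map_mem_maximal_iff (locSub R S p) p _ inferInstance).2 hc
    rw [map_sub] at this
    exact this
  obtain ⟨⟨s, u⟩, h⟩ := IsLocalization.surj p.primeCompl b
  obtain ⟨v, hv⟩ := (IsLocalization.map_units (locSub R S p) u).exists_left_inv
  have hb : b = algebraMap S (locSub R S p) s * v := by
    rw [← h]
    linear_combination (-b) * hv
  rw [hb]
  exact mul_mem (hS' s) (mem_scalarsAddIdeal_of_mul_eq_one
    (maximalIdeal.isMaximal _).ne_top (hS' u) hv)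

lemma QuadStep.exists_parameters [IsAlgClosed k] {A B : Subalgebra R (FractionRing R)}
    [IsNoetherianRing A] (h : QuadStep R A B) {n : ℕ} (hA : ringKrullDim A ≤ n)
    (hB : n ≤ ringKrullDim B) (hres : ∀ a, a ∈ scalarsAddIdeal k (nuIdeal A))
    (y : Fin n → A) (hy : Ideal.span (Set.range y) = nuIdeal A) :
    (∀ b, b ∈ scalarsAddIdeal k (nuIdeal B)) ∧
      ∃ y' : Fin n → B, Ideal.span (Set.range y') = nuIdeal B ∧
        ∀ i, (y i : FractionRing R) ∈
          Algebra.adjoin k (Set.range fun j ↦ (y' j : FractionRing R)) := by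
  obtain ⟨hlocal, -, -⟩ := h.isLocalRing_and_ringKrullDim_le
  obtain ⟨x, hxm, hxm2, p, hp, hxp, rfl⟩ := h
  let S := S1 R A x
  let := locSubAlgebra R S p
  have hloc := isLocalization_locSub R S p
  obtain ⟨hN, hd⟩ := ringKrullDim_S1_le R A x
  have hx0 : x ≠ 0 := fun h ↦ hxm2 (h ▸ Ideal.zero_mem _)
  have hx0' : (x : FractionRing R) ≠ 0 := fun h ↦ hx0 (Subtype.ext h)
  rw [IsLocalization.AtPrime.ringKrullDim_eq_height p] at hB
  have hmax : p.IsMaximal := isMaximal_of_ringKrullDim_le_height (hd.trans hA) hB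
  have hBres : ∀ b, b ∈ scalarsAddIdeal k (maximalIdeal (locSub R S p)) :=
    mem_scalarsAddIdeal_locSub R S p
      (mem_scalarsAddIdeal_S1 R A y hy hres x hx0 p hxp)
  rw [nuIdeal_eq_maximalIdeal]
  refine ⟨hBres, ?_⟩
  have hSB := le_locSub R S p
  have hAB : A ≤ locSub R S p := (le_S1 R A x).trans hSB
  let i : A →ₐ[R] locSub R S p := Subalgebra.inclusion hAB
  let t : Fin n → locSub R S p := fun l ↦ ⟨(y l : FractionRing R) / x,
    hSB (Algebra.subset_adjoin (Or.inr ⟨y l, hy ▸ Ideal.subset_span ⟨l, rfl⟩, rfl⟩))⟩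
  have hit : ∀ l, i (y l) = i x * t l := fun l ↦ Subtype.ext (by
    change (y l : FractionRing R) = x * (y l / x)
    field_simp)
  have hnu : ∀ a ∈ nuIdeal A, i a ∈ Ideal.span (Set.range fun l ↦ i x * t l) := by
    intro a ha
    rw [← hy] at ha
    refine (Ideal.span_le.2 ?_ : Ideal.span (Set.range y) ≤
      (Ideal.span (Set.range fun l ↦ i x * t l)).comap i) ha
    rintro _ ⟨l, rfl⟩
    exact Ideal.subset_span ⟨l, (hit l).symm⟩
  have hires : ∀ a, i a ∈ scalarsAddIdeal k (Ideal.span (Set.range fun l ↦ i x * t l)) := by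
    intro a
    obtain ⟨c, hc⟩ := mem_scalarsAddIdeal.1 (hres a)
    refine mem_scalarsAddIdeal.2 ⟨c, ?_⟩
    have := hnu _ hc
    rwa [map_sub] at this
  obtain ⟨r, hr⟩ := Ideal.mem_span_range_iff_exists_fun.1 (hy ▸ hxm)
  have hrt : ∑ l, i (r l) * t l = 1 := by
    have hix0 : i x ≠ 0 := fun h ↦ hx0' (congrArg Subtype.val h)
    apply mul_left_cancel₀ hix0
    rw [Finset.mul_sum, mul_one]
    conv_rhs => rw [← hr, map_sum]
    refine Finset.sum_congr rfl fun l _ ↦ ?_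
    rw [map_mul, hit]
    ring
  have hixm : i x ∈ maximalIdeal (locSub R S p) :=
    (IsLocalization.AtPrime.to_map_mem_maximal_iff (locSub R S p) p _ hlocal).2 hxp
  obtain ⟨y', hym, hyt, hxI, htI⟩ := exists_monoidal_parameters hBres hixm t (fun l ↦ i (r l)) hrt
    fun l ↦ hires (r l)
  set I := Ideal.span (Set.range y')
  have hIm : I ≤ maximalIdeal (locSub R S p) := Ideal.span_le.2 (by rintro _ ⟨l, rfl⟩; exact hym l)
  have hItop : I ≠ ⊤ := fun h ↦ (maximalIdeal.isMaximal _).ne_top (eq_top_iff.2 (h ▸ hIm))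
  have hAI : ∀ a, i a ∈ scalarsAddIdeal k I := by
    intro a
    obtain ⟨c, hc⟩ := mem_scalarsAddIdeal.1 (hires a)
    refine mem_scalarsAddIdeal.2 ⟨c, (Ideal.span_le.2 ?_ : Ideal.span _ ≤ I) hc⟩
    rintro _ ⟨l, rfl⟩
    exact I.mul_mem_right _ hxI
  have hSI : ∀ s : S, algebraMap S (locSub R S p) s ∈ scalarsAddIdeal k I := by
    rintro ⟨z, hz⟩
    have hz' := hz
    simp only [S] at hz'
    rw [S1_eq_adjoin_of_span R A x _ hy] at hz'
    suffices ∀ hz : z ∈ locSub R S p, (⟨z, hz⟩ : locSub R S p) ∈ scalarsAddIdeal k I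
      from this (hSB hz)
    clear hz
    have hle : Algebra.adjoin R ((A : Set (FractionRing R)) ∪
        (fun a : A ↦ (a : FractionRing R) / (x : FractionRing R)) '' Set.range y) ≤
        locSub R S p := S1_eq_adjoin_of_span R A x _ hy ▸ hSB
    induction hz' using Algebra.adjoin_induction with
    | mem z hz =>
      intro _
      rcases hz with hz | ⟨_, ⟨l, rfl⟩, rfl⟩
      · exact hAI ⟨z, hz⟩
      · exact htI l
    | algebraMap r =>
      intro _
      exact hAI (algebraMap R A r)
    | add a b ha hb iha ihb =>
      intro _
      exact add_mem (iha (hle ha)) (ihb (hle hb))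
    | mul a b ha hb iha ihb =>
      intro _
      exact mul_mem (iha (hle ha)) (ihb (hle hb))
  refine ⟨y', le_antisymm hIm fun b hb ↦ ?_, fun l ↦ ?_⟩
  · have hbI : b ∈ scalarsAddIdeal k I := by
      obtain ⟨⟨s, u⟩, h⟩ := IsLocalization.surj p.primeCompl b
      obtain ⟨v, hv⟩ := (IsLocalization.map_units (locSub R S p) u).exists_left_inv
      have hb : b = algebraMap S (locSub R S p) s * v := by
        rw [← h]
        linear_combination (-b) * hv
      rw [hb]
      exact mul_mem (hSI s) (mem_scalarsAddIdeal_of_mul_eq_one hItop (hSI u) hv)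
    obtain ⟨c, hc⟩ := mem_scalarsAddIdeal.1 hbI
    by_cases hc0 : c = 0
    · simpa [hc0] using hc
    · have h1 := (maximalIdeal (locSub R S p)).sub_mem hb (hIm hc)
      rw [sub_sub_cancel] at h1
      exact absurd ((IsUnit.mk0 c hc0).map (algebraMap k (locSub R S p)))
        ((mem_maximalIdeal _).1 h1)
  · have h1 := hyt l
    rw [← hit] at h1
    let f : locSub R S p →ₐ[k] FractionRing R := (locSub R S p).val.restrictScalars k
    have h2 := AlgHom.map_adjoin f (Set.range y')
    rw [← Set.range_comp] at h2
    change f (i (y l)) ∈ Algebra.adjoin k (Set.range (f ∘ y'))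
    exact h2 ▸ ⟨_, h1, rfl⟩

end Step

/-- Let `(R, m)` be an `n`-dimensional local regular domain (`n > 1`)
containing an algebraically closed field `k` with `k ≅ R/m`, and let `(T, nT)` be an
`n`-dimensional local regular domain obtained from `R` by a finite sequence of quadratic
transformations `R = R₀ ⊆ R₁ ⊆ ⋯ ⊆ R_m = T` (inside the fraction field of `R`).  Let
`x₁,...,xₙ` generate `m`.  Then there exist a regular system of parameters `y₁,...,yₙ` of `T`
and polynomials `A₁,...,Aₙ ∈ k[Y₁,...,Yₙ]` such that `x_j = A_j(y₁,...,yₙ)` for each `j`. -/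
theorem exists_polynomial_expression_of_quadratic_sequence
    (k : Type*) [Field k] [IsAlgClosed k]
    (R : Type*) [CommRing R] [IsDomain R] [IsLocalRing R] [Algebra k R]
    (hres : Function.Bijective ((residue R).comp (algebraMap k R)))
    (n : ℕ) (hn : 1 < n) (hreg : IsRegLoc R) (hdim : ringKrullDim R = (n : ℕ))
    (x : Fin n → R) (hx : Ideal.span (Set.range x) = maximalIdeal R)
    (m : ℕ) (chain : Fin (m + 1) → Subalgebra R (FractionRing R))
    (hc0 : chain 0 = ⊥)
    (hstep : ∀ i : Fin m, QuadStep R (chain i.castSucc) (chain i.succ))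
    (T : Subalgebra R (FractionRing R)) (hcT : chain (Fin.last m) = T)
    (hTreg : IsRegLoc T) (hTdim : ringKrullDim T = (n : ℕ)) :
    ∃ y : Fin n → T, Ideal.span (Set.range y) = nuIdeal T ∧
      ∃ A : Fin n → MvPolynomial (Fin n) k,
        ∀ j : Fin n,
          @MvPolynomial.aeval k T (Fin n) _ _
            ((algebraMap R T).comp (algebraMap k R)).toAlgebra y (A j)
          = algebraMap R T (x j) := by
  have hN0 : IsNoetherianRing R := hreg.2.1
  let e : R ≃+* (⊥ : Subalgebra R (FractionRing R)) :=
    (Algebra.botEquivOfInjective (IsFractionRing.injective R (FractionRing R))).symm.toRingEquiv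
  have hchain : ∀ i, IsLocalRing (chain i) ∧ IsNoetherianRing (chain i) ∧
      ringKrullDim (chain i) ≤ n := by
    intro i
    induction i using Fin.induction with
    | zero =>
      rw [hc0]
      exact ⟨e.isLocalRing, isNoetherianRing_of_ringEquiv R e,
        (hdim ▸ ringKrullDim_eq_of_ringEquiv e).ge⟩
    | succ i ih =>
      have := ih.2.1
      obtain ⟨h1, h2, h3⟩ := (hstep i).isLocalRing_and_ringKrullDim_le
      exact ⟨h1, h2, h3.trans ih.2.2⟩
  have hchain' : ∀ i, n ≤ ringKrullDim (chain i) := by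
    intro i
    induction i using Fin.reverseInduction with
    | last => rw [hcT, hTdim]
    | cast i ih =>
      have := (hchain i.castSucc).2.1
      exact ih.trans (hstep i).isLocalRing_and_ringKrullDim_le.2.2
  have key : ∀ i, (∀ a, a ∈ scalarsAddIdeal k (nuIdeal (chain i))) ∧
      ∃ y : Fin n → chain i, Ideal.span (Set.range y) = nuIdeal (chain i) ∧
        ∀ j, algebraMap R (FractionRing R) (x j) ∈
          Algebra.adjoin k (Set.range fun l ↦ (y l : FractionRing R)) := by
    intro i
    induction i using Fin.induction with
    | zero =>
      rw [hc0]
      have : IsLocalRing (⊥ : Subalgebra R (FractionRing R)) := e.isLocalRing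
      have he : (maximalIdeal R).map e = maximalIdeal (⊥ : Subalgebra R (FractionRing R)) := by
        rw [← Ideal.comap_symm]
        exact eq_maximalIdeal (Ideal.comap_isMaximal_of_equiv e.symm)
      rw [nuIdeal_eq_maximalIdeal, ← he]
      refine ⟨fun a ↦ ?_, fun l ↦ e (x l), ?_, fun j ↦ Algebra.subset_adjoin ⟨j, rfl⟩⟩
      · obtain ⟨r, rfl⟩ := e.surjective a
        obtain ⟨c, hc⟩ := hres.2 (residue R r)
        refine mem_scalarsAddIdeal.2 ⟨c, ?_⟩
        have h1 : r - algebraMap k R c ∈ maximalIdeal R := Ideal.Quotient.eq.1 hc.symm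
        have h2 := Ideal.mem_map_of_mem e h1
        rwa [map_sub] at h2
      · rw [← hx, Ideal.map_span, ← Set.range_comp]
        rfl
    | succ i ih =>
      obtain ⟨h1, y, hy, hxy⟩ := ih
      have := (hchain i.castSucc).2.1
      obtain ⟨h2, y', hy', hyy'⟩ := (hstep i).exists_parameters R (hchain i.castSucc).2.2
        (hchain' i.succ) h1 y hy
      refine ⟨h2, y', hy', fun j ↦ ?_⟩
      refine (Algebra.adjoin_le ?_ : Algebra.adjoin k _ ≤ _) (hxy j)
      rintro _ ⟨l, rfl⟩
      exact hyy' l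
  subst hcT
  obtain ⟨-, y, hy, hxy⟩ := key (Fin.last m)
  refine ⟨y, hy, ?_⟩
  simp_rw [Algebra.adjoin_range_eq_range_aeval] at hxy
  choose A hA using hxy
  refine ⟨A, fun j ↦ Subtype.ext ?_⟩
  let f : chain (Fin.last m) →ₐ[k] FractionRing R := (chain (Fin.last m)).val.restrictScalars k
  change f (MvPolynomial.eval₂ (algebraMap k (chain (Fin.last m))) y (A j)) = _
  rw [← MvPolynomial.aeval_def, MvPolynomial.comp_aeval_apply]
  exact hA j

end
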